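/- arXiv:2501.01772 — 2 statements merged into one kernel-verified Lean document; each statement's English description precedes it below -/
import Mathlib

section
/- Let (u(n))_{n∈ℕ} be a Markov chain with state space (H, 𝔅(H)). If for any x, x̃ ∈ H there exists a generalized coupling ξ = ξ_{x,x̃} ∈ Ĉ(ℙ_x, ℙ_{x̃}) such that ξ({(u, ũ) ∈ H^ℕ × H^ℕ : lim_{n→∞} ‖u(n) − ũ(n)‖_H = 0}) > 0, then the chain has at most one ergodic invariant probability measure supported on H. -/
/-!
STATEMENT 8 (Glatt-Holtz–Mattingly–Richards generalized coupling criterion).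
`(u(n))` is a Markov chain on a separable Hilbert space `H` with transition
kernel `κ`; `law x` denotes the law `ℙ_x` on the path space `H^ℕ` of the
chain started from `x` (characterized by `ω 0 = x` a.s. and the Markov
property).  A generalized coupling of `ℙ_x, ℙ_y` is a probability measure on
`H^ℕ × H^ℕ` whose marginals are absolutely continuous with respect to
`ℙ_x` and `ℙ_y` respectively.  An invariant probability measure `μ` for `κ`
(`μ.bind κ = μ`) is ergodic if every invariant set has `μ`-measure `0` or
`1`.
-/

open MeasureTheory ProbabilityTheory Filter
open scoped ENNReal Topology

namespace GeneralizedCoupling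

section BoundedMeasurable

variable {X : Type*} [MeasurableSpace X]

/-- Bounded measurable real functions. -/
def IsBddMeas (f : X → ℝ) : Prop := Measurable f ∧ ∃ C, ∀ x, |f x| ≤ C

/-- The Markov operator `f ↦ (x ↦ ∫ f dκ(x))` of a kernel. -/
noncomputable def markovOp (κ : Kernel X X) (f : X → ℝ) (x : X) : ℝ := ∫ y, f y ∂κ x

namespace IsBddMeas

variable {f g : X → ℝ}

lemma const (c : ℝ) : IsBddMeas fun _ : X => c := ⟨measurable_const, |c|, fun _ => le_rfl⟩

lemma add (hf : IsBddMeas f) (hg : IsBddMeas g) : IsBddMeas fun x => f x + g x := by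
  obtain ⟨hf, C, hC⟩ := hf
  obtain ⟨hg, D, hD⟩ := hg
  exact ⟨hf.add hg, C + D, fun x => (abs_add_le _ _).trans (add_le_add (hC x) (hD x))⟩

lemma mul (hf : IsBddMeas f) (hg : IsBddMeas g) : IsBddMeas fun x => f x * g x := by
  obtain ⟨hf, C, hC⟩ := hf
  obtain ⟨hg, D, hD⟩ := hg
  refine ⟨hf.mul hg, C * D, fun x => ?_⟩
  rw [abs_mul]
  exact mul_le_mul (hC x) (hD x) (abs_nonneg _) ((abs_nonneg _).trans (hC x))

lemma sum {ι : Type*} (s : Finset ι) {f : ι → X → ℝ} (hf : ∀ i ∈ s, IsBddMeas (f i)) :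
    IsBddMeas fun x => ∑ i ∈ s, f i x := by
  classical
  induction s using Finset.induction_on with
  | empty => simpa using const (X := X) 0
  | insert i s hi ih =>
    simp only [Finset.sum_insert hi]
    exact (hf i (by simp)).add (ih fun j hj => hf j (by simp [hj]))

lemma comp {Y : Type*} [MeasurableSpace Y] (hf : IsBddMeas f) {φ : Y → X} (hφ : Measurable φ) :
    IsBddMeas fun y => f (φ y) :=
  ⟨hf.1.comp hφ, hf.2.imp fun _ hC y => hC (φ y)⟩

lemma integrable (hf : IsBddMeas f) (μ : Measure X) [IsFiniteMeasure μ] : Integrable f μ := by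
  obtain ⟨hf, C, hC⟩ := hf
  exact Integrable.of_bound hf.aestronglyMeasurable C (.of_forall hC)

lemma memLp (hf : IsBddMeas f) (p : ℝ≥0∞) (μ : Measure X) [IsFiniteMeasure μ] : MemLp f p μ := by
  obtain ⟨hf, C, hC⟩ := hf
  exact MemLp.of_bound hf.aestronglyMeasurable C (.of_forall hC)

lemma markovOp (κ : Kernel X X) [IsMarkovKernel κ] (hf : IsBddMeas f) :
    IsBddMeas (markovOp κ f) := by
  obtain ⟨hf, C, hC⟩ := hf
  refine ⟨(hf.stronglyMeasurable.integral_kernel (κ := κ)).measurable, C, fun x => ?_⟩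
  have : ∀ᵐ y ∂κ x, ‖f y‖ ≤ C := .of_forall hC
  simpa [GeneralizedCoupling.markovOp] using norm_integral_le_of_norm_le_const this

lemma iterate_markovOp (κ : Kernel X X) [IsMarkovKernel κ] (hf : IsBddMeas f) (n : ℕ) :
    IsBddMeas ((GeneralizedCoupling.markovOp κ)^[n] f) := by
  induction n generalizing f with
  | zero => exact hf
  | succ n ih => exact ih (hf.markovOp κ)

end IsBddMeas

lemma inner_toLp_toLp {μ : Measure X} {f g : X → ℝ} (hf : MemLp f 2 μ) (hg : MemLp g 2 μ) :
    inner ℝ (hf.toLp f) (hg.toLp g) = ∫ x, f x * g x ∂μ := by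
  rw [L2.inner_def]
  refine integral_congr_ae ?_
  filter_upwards [hf.coeFn_toLp, hg.coeFn_toLp] with x h₁ h₂
  simp only [RCLike.inner_apply, conj_trivial, h₁, h₂, mul_comm]

end BoundedMeasurable

section Subsequence

variable {α : Type*} [MeasurableSpace α] {μ : Measure α}

lemma exists_subseq_tendsto_ae {φ : ℕ → α → ℝ} (hint : ∀ n, Integrable (φ n) μ)
    (hnonneg : ∀ n x, 0 ≤ φ n x) (hlim : Tendsto (fun n => ∫ x, φ n x ∂μ) atTop (𝓝 0)) :
    ∃ ns : ℕ → ℕ, StrictMono ns ∧ ∀ᵐ x ∂μ, Tendsto (fun i => φ (ns i) x) atTop (𝓝 0) := by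
  have hmeas : TendstoInMeasure μ φ atTop (fun _ => (0 : ℝ)) := by
    refine tendstoInMeasure_of_tendsto_eLpNorm (p := 1) one_ne_zero
      (fun n => (hint n).aestronglyMeasurable) aestronglyMeasurable_const ?_
    have : ∀ n, eLpNorm (φ n - fun _ => (0 : ℝ)) 1 μ = ENNReal.ofReal (∫ x, φ n x ∂μ) := by
      intro n
      rw [eLpNorm_one_eq_lintegral_enorm,
        ofReal_integral_eq_lintegral_ofReal (hint n) (.of_forall (hnonneg n))]
      refine lintegral_congr fun x => ?_
      simp [Real.enorm_of_nonneg (hnonneg n x)]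
    simp_rw [this]
    simpa using ENNReal.tendsto_ofReal hlim
  exact hmeas.exists_seq_tendsto_ae

end Subsequence
section PathLaw

variable {X : Type*} [MeasurableSpace X] {κ : Kernel X X} [IsMarkovKernel κ]
  {ν : Measure (ℕ → X)} [IsProbabilityMeasure ν] {x : X} {g h : X → ℝ}

/-- `ν` satisfies the one-step Markov property with transition kernel `κ`. -/
def IsMarkovLaw (κ : Kernel X X) (ν : Measure (ℕ → X)) : Prop :=
  ∀ n : ℕ, Measure.map (fun ω => (fun i : Fin (n + 1) => ω i, ω (n + 1))) ν =
    (Measure.map (fun ω (i : Fin (n + 1)) => ω i) ν) ⊗ₘ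
      (κ.comap (fun v : Fin (n + 1) → X => v (Fin.last n)) (measurable_pi_apply _))

lemma IsMarkovLaw.integral_mul_succ (hν : IsMarkovLaw κ ν) (hg : IsBddMeas g) (hh : IsBddMeas h)
    {j n : ℕ} (hj : j ≤ n) :
    ∫ ω, g (ω j) * h (ω (n + 1)) ∂ν = ∫ ω, g (ω j) * markovOp κ h (ω n) ∂ν := by
  have hpast : Measurable fun (ω : ℕ → X) (i : Fin (n + 1)) => ω i := by fun_prop
  have hpair : Measurable fun ω : ℕ → X => ((fun i : Fin (n + 1) => ω i), ω (n + 1)) := by fun_prop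
  let k : Fin (n + 1) := ⟨j, by omega⟩
  have hφ : IsBddMeas fun p : (Fin (n + 1) → X) × X => g (p.1 k) * h p.2 :=
    (hg.comp (by fun_prop)).mul (hh.comp measurable_snd)
  have hψ : IsBddMeas fun v : Fin (n + 1) → X => g (v k) * markovOp κ h (v (Fin.last n)) :=
    (hg.comp (by fun_prop)).mul ((hh.markovOp κ).comp (by fun_prop))
  have : IsProbabilityMeasure (ν.map fun ω (i : Fin (n + 1)) => ω i) :=
    Measure.isProbabilityMeasure_map hpast.aemeasurable
  calc ∫ ω, g (ω j) * h (ω (n + 1)) ∂ν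
      = ∫ p, g (p.1 k) * h p.2
          ∂(ν.map fun ω => (fun i : Fin (n + 1) => ω i, ω (n + 1))) :=
        (integral_map hpair.aemeasurable hφ.1.aestronglyMeasurable).symm
    _ = ∫ v, g (v k) * markovOp κ h (v (Fin.last n))
          ∂(ν.map fun ω (i : Fin (n + 1)) => ω i) := by
        rw [hν n, Measure.integral_compProd (hφ.integrable _)]
        simp only [Kernel.comap_apply, integral_const_mul, markovOp]
    _ = ∫ ω, g (ω j) * markovOp κ h (ω n) ∂ν :=
        integral_map hpast.aemeasurable hψ.1.aestronglyMeasurable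

lemma IsMarkovLaw.integral_mul_add (hν : IsMarkovLaw κ ν) (hg : IsBddMeas g) (hh : IsBddMeas h)
    (j m : ℕ) :
    ∫ ω, g (ω j) * h (ω (j + m)) ∂ν = ∫ ω, g (ω j) * (markovOp κ)^[m] h (ω j) ∂ν := by
  induction m generalizing h with
  | zero => rfl
  | succ m ih =>
    rw [← add_assoc, hν.integral_mul_succ hg hh (Nat.le_add_right j m), ih (hh.markovOp κ),
      Function.iterate_succ_apply]

lemma IsMarkovLaw.integral_eval (hν : IsMarkovLaw κ ν)
    (hν₀ : ν.map (fun ω => ω 0) = Measure.dirac x) (hh : IsBddMeas h) (n : ℕ) :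
    ∫ ω, h (ω n) ∂ν = (markovOp κ)^[n] h x := by
  induction n generalizing h with
  | zero =>
    rw [← integral_map (measurable_pi_apply 0).aemeasurable hh.1.aestronglyMeasurable, hν₀,
      integral_dirac' _ _ hh.1.stronglyMeasurable]
    rfl
  | succ n ih =>
    have := hν.integral_mul_succ (IsBddMeas.const 1) hh (le_refl n)
    simp only [one_mul] at this
    rw [this, ih (hh.markovOp κ), Function.iterate_succ_apply]

/-- The second moment of `∑ i < n, g (u i)` for the chain `u` with kernel `κ`, as a function of the
initial state. -/
noncomputable def secondMoment (κ : Kernel X X) (g : X → ℝ) : ℕ → X → ℝ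
  | 0, _ => 0
  | n + 1, x => secondMoment κ g n x
      + 2 * ∑ j ∈ Finset.range n, (markovOp κ)^[j] (fun y => g y * (markovOp κ)^[n - j] g y) x
      + (markovOp κ)^[n] (fun y => g y * g y) x

lemma IsBddMeas.secondMoment (hg : IsBddMeas g) (n : ℕ) : IsBddMeas (secondMoment κ g n) := by
  induction n with
  | zero => exact IsBddMeas.const 0
  | succ n ih =>
    exact (ih.add ((IsBddMeas.const 2).mul (IsBddMeas.sum _ fun j _ =>
      (hg.mul (hg.iterate_markovOp κ _)).iterate_markovOp κ j))).add
        ((hg.mul hg).iterate_markovOp κ n)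

lemma IsBddMeas.pathSum (hg : IsBddMeas g) (n : ℕ) :
    IsBddMeas fun ω : ℕ → X => ∑ i ∈ Finset.range n, g (ω i) :=
  IsBddMeas.sum _ fun i _ => hg.comp (measurable_pi_apply i)

lemma IsMarkovLaw.integral_sum_sq (hν : IsMarkovLaw κ ν)
    (hν₀ : ν.map (fun ω => ω 0) = Measure.dirac x) (hg : IsBddMeas g) (n : ℕ) :
    ∫ ω, (∑ i ∈ Finset.range n, g (ω i)) ^ 2 ∂ν = secondMoment κ g n x := by
  induction n with
  | zero => simp [secondMoment]
  | succ n ih =>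
    have hsum := hg.pathSum n
    have hgi (i : ℕ) : IsBddMeas fun ω : ℕ → X => g (ω i) := hg.comp (measurable_pi_apply i)
    have hexp (ω : ℕ → X) : (∑ i ∈ Finset.range (n + 1), g (ω i)) ^ 2 =
        ((∑ i ∈ Finset.range n, g (ω i)) * (∑ i ∈ Finset.range n, g (ω i))
          + 2 * ∑ j ∈ Finset.range n, g (ω j) * g (ω n)) + g (ω n) * g (ω n) := by
      rw [Finset.sum_range_succ, ← Finset.sum_mul]
      ring
    have hcross (j : ℕ) (hj : j ∈ Finset.range n) : ∫ ω, g (ω j) * g (ω n) ∂ν =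
        (markovOp κ)^[j] (fun y => g y * (markovOp κ)^[n - j] g y) x := by
      have hjn : j + (n - j) = n := Nat.add_sub_cancel' (Finset.mem_range.1 hj).le
      have := hν.integral_mul_add hg hg j (n - j)
      rw [hjn] at this
      rw [this]
      exact hν.integral_eval hν₀ (hg.mul (hg.iterate_markovOp κ _)) j
    have h₁ := hsum.mul hsum
    have h₂ := (IsBddMeas.const 2).mul
      (IsBddMeas.sum (Finset.range n) fun j _ => (hgi j).mul (hgi n))
    simp_rw [hexp]
    rw [integral_add ((h₁.add h₂).integrable ν) (((hgi n).mul (hgi n)).integrable ν),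
      integral_add (h₁.integrable ν) (h₂.integrable ν), integral_const_mul,
      integral_finsetSum _ fun j _ => ((hgi j).mul (hgi n)).integrable ν,
      Finset.sum_congr rfl hcross, hν.integral_eval hν₀ (hg.mul hg) n]
    simp_rw [← pow_two (∑ i ∈ Finset.range n, g _)]
    rw [ih]
    rfl

end PathLaw

section MeanErgodic

variable {X : Type*} [MeasurableSpace X] {κ : Kernel X X} [IsMarkovKernel κ]
  {μ : Measure X} [IsProbabilityMeasure μ] {f g h : X → ℝ}

lemma measurePreserving_fst_compProd : MeasurePreserving Prod.fst (μ ⊗ₘ κ) μ :=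
  ⟨measurable_fst, Measure.fst_compProd μ κ⟩

lemma measurePreserving_snd_compProd (hμ : μ.bind κ = μ) :
    MeasurePreserving Prod.snd (μ ⊗ₘ κ) μ :=
  ⟨measurable_snd, (Measure.snd_compProd μ κ).trans hμ⟩

lemma integral_markovOp (hμ : μ.bind κ = μ) (hf : IsBddMeas f) :
    ∫ x, markovOp κ f x ∂μ = ∫ x, f x ∂μ := by
  have hf' : IsBddMeas fun p : X × X => f p.2 := hf.comp measurable_snd
  calc ∫ x, markovOp κ f x ∂μ = ∫ p, f p.2 ∂(μ ⊗ₘ κ) :=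
        (Measure.integral_compProd (hf'.integrable _)).symm
    _ = ∫ x, f x ∂((μ ⊗ₘ κ).map Prod.snd) :=
        (integral_map measurable_snd.aemeasurable hf.1.aestronglyMeasurable).symm
    _ = ∫ x, f x ∂μ := by rw [(measurePreserving_snd_compProd hμ).map_eq]

lemma integral_iterate_markovOp (hμ : μ.bind κ = μ) (hf : IsBddMeas f) (n : ℕ) :
    ∫ x, (markovOp κ)^[n] f x ∂μ = ∫ x, f x ∂μ := by
  induction n generalizing f with
  | zero => rfl
  | succ n ih => rw [Function.iterate_succ_apply, ih (hf.markovOp κ), integral_markovOp hμ hf]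

lemma integral_secondMoment_succ (hμ : μ.bind κ = μ) (hg : IsBddMeas g) (n : ℕ) :
    ∫ x, secondMoment κ g (n + 1) x ∂μ = ∫ x, secondMoment κ g n x ∂μ
      + (2 * ∑ m ∈ Finset.range (n + 1), ∫ x, g x * (markovOp κ)^[m] g x ∂μ
        - ∫ x, g x * g x ∂μ) := by
  have hcorr (m : ℕ) : IsBddMeas fun y => g y * (markovOp κ)^[m] g y :=
    hg.mul (hg.iterate_markovOp κ m)
  have h₁ := hg.secondMoment (κ := κ) n
  have h₂ (j : ℕ) := (hcorr (n - j)).iterate_markovOp κ j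
  have h₃ := (IsBddMeas.const 2).mul (IsBddMeas.sum (Finset.range n) fun j _ => h₂ j)
  simp only [secondMoment]
  rw [integral_add ((h₁.add h₃).integrable μ) (((hg.mul hg).iterate_markovOp κ n).integrable μ),
    integral_add (h₁.integrable μ) (h₃.integrable μ), integral_const_mul,
    integral_finsetSum _ fun j _ => (h₂ j).integrable μ,
    Finset.sum_congr rfl fun j _ => integral_iterate_markovOp hμ (hcorr (n - j)) j,
    integral_iterate_markovOp hμ (hg.mul hg), Finset.sum_range_succ',
    ← Finset.sum_range_reflect]
  have : ∑ j ∈ Finset.range n, ∫ x, g x * (markovOp κ)^[n - (n - 1 - j)] g x ∂μ =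
      ∑ m ∈ Finset.range n, ∫ x, g x * (markovOp κ)^[m + 1] g x ∂μ := by
    refine Finset.sum_congr rfl fun j hj => ?_
    rw [show n - (n - 1 - j) = j + 1 by have := Finset.mem_range.1 hj; omega]
  rw [this]
  simp only [Function.iterate_zero, id]
  ring

/-- Every measurable set that is absorbing `μ`-a.e. is `μ`-trivial. -/
def IsErgodicMeasure (κ : Kernel X X) (μ : Measure X) : Prop :=
  ∀ A : Set X, MeasurableSet A → (∀ᵐ x ∂μ, x ∈ A → κ x A = 1) → μ A = 0 ∨ μ A = 1

lemma IsErgodicMeasure.ae_eq_const (hμ : IsErgodicMeasure κ μ) (hf : Measurable f)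
    (hinv : ∀ᵐ p ∂(μ ⊗ₘ κ), f p.1 = f p.2) : ∃ c : ℝ, f =ᵐ[μ] fun _ => c := by
  refine exists_eventuallyEq_const_of_forall_separating MeasurableSet fun U hU => ?_
  have habs : ∀ᵐ x ∂μ, x ∈ f ⁻¹' U → κ x (f ⁻¹' U) = 1 := by
    filter_upwards [Measure.ae_ae_of_ae_compProd hinv] with x hx hxU
    rw [← prob_compl_eq_zero_iff (hf hU)]
    filter_upwards [hx] with y hy
    change f y ∈ U
    exact hy ▸ hxU
  rcases hμ _ (hf hU) habs with h | h
  · exact .inr (measure_eq_zero_iff_ae_notMem.1 h)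
  · exact .inl ((prob_compl_eq_zero_iff (hf hU)).2 h)

/-- The Markov operator of an invariant measure, as a contraction of `L²`: the adjoint of
`f ↦ f ∘ fst` composed with `f ↦ f ∘ snd`, between `L²(μ)` and `L²(μ ⊗ κ)`. -/
noncomputable def markovL2 (hμ : μ.bind κ = μ) : Lp ℝ 2 μ →L[ℝ] Lp ℝ 2 μ :=
  (ContinuousLinearMap.adjoint (Lp.compMeasurePreservingₗᵢ ℝ Prod.fst
    (measurePreserving_fst_compProd (κ := κ) (μ := μ))).toContinuousLinearMap) ∘L
  (Lp.compMeasurePreservingₗᵢ ℝ Prod.snd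
    (measurePreserving_snd_compProd hμ)).toContinuousLinearMap

lemma inner_markovL2 (hμ : μ.bind κ = μ) (F G : Lp ℝ 2 μ) :
    inner ℝ F (markovL2 hμ G) =
      inner ℝ (Lp.compMeasurePreserving Prod.fst
          (measurePreserving_fst_compProd (κ := κ) (μ := μ)) F)
        (Lp.compMeasurePreserving Prod.snd (measurePreserving_snd_compProd hμ) G) := by
  simp only [markovL2, ContinuousLinearMap.comp_apply, ContinuousLinearMap.adjoint_inner_right]
  rfl

lemma norm_markovL2_le (hμ : μ.bind κ = μ) : ‖markovL2 hμ‖ ≤ 1 := by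
  refine (ContinuousLinearMap.opNorm_comp_le _ _).trans ?_
  rw [LinearIsometryEquiv.norm_map]
  exact mul_le_one₀ (LinearIsometry.norm_toContinuousLinearMap_le _) (norm_nonneg _)
    (LinearIsometry.norm_toContinuousLinearMap_le _)

lemma markovL2_toLp (hμ : μ.bind κ = μ) (hf : IsBddMeas f) :
    markovL2 hμ ((hf.memLp 2 μ).toLp f) =
      (((hf.markovOp κ).memLp 2 μ).toLp (markovOp κ f)) := by
  refine ext_inner_left ℝ fun F => ?_
  rw [inner_markovL2, L2.inner_def, L2.inner_def]
  have hF := Lp.coeFn_compMeasurePreserving F (measurePreserving_fst_compProd (κ := κ) (μ := μ))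
  have hG := (Lp.coeFn_compMeasurePreserving ((hf.memLp 2 μ).toLp f)
    (measurePreserving_snd_compProd hμ)).trans
    ((measurePreserving_snd_compProd hμ).quasiMeasurePreserving.ae_eq_comp
      (hf.memLp 2 μ).coeFn_toLp)
  have hint : Integrable (fun p : X × X => F p.1 * f p.2) (μ ⊗ₘ κ) := by
    have := L2.integrable_inner (𝕜 := ℝ) (Lp.compMeasurePreserving Prod.fst
          (measurePreserving_fst_compProd (κ := κ) (μ := μ)) F)
        (Lp.compMeasurePreserving Prod.snd (measurePreserving_snd_compProd hμ)
          ((hf.memLp 2 μ).toLp f))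
    refine this.congr ?_
    filter_upwards [hF, hG] with p h₁ h₂
    simp only [RCLike.inner_apply, conj_trivial, h₁, h₂, Function.comp_apply, mul_comm]
  calc _ = ∫ p, F p.1 * f p.2 ∂(μ ⊗ₘ κ) := by
        refine integral_congr_ae ?_
        filter_upwards [hF, hG] with p h₁ h₂
        simp only [RCLike.inner_apply, conj_trivial, h₁, h₂, Function.comp_apply, mul_comm]
    _ = ∫ x, F x * markovOp κ f x ∂μ := by
        rw [Measure.integral_compProd hint]
        simp only [integral_const_mul, markovOp]
    _ = _ := by
        refine integral_congr_ae ?_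
        filter_upwards [((hf.markovOp κ).memLp 2 μ).coeFn_toLp] with x hx
        simp only [RCLike.inner_apply, conj_trivial, hx, mul_comm]

lemma iterate_markovL2_toLp (hμ : μ.bind κ = μ) (hf : IsBddMeas f) (n : ℕ) :
    (markovL2 hμ)^[n] ((hf.memLp 2 μ).toLp f) =
      ((hf.iterate_markovOp κ n).memLp 2 μ).toLp ((markovOp κ)^[n] f) := by
  induction n generalizing f with
  | zero => rfl
  | succ n ih => rw [Function.iterate_succ_apply, markovL2_toLp hμ hf, ih (hf.markovOp κ)]; rfl

lemma IsErgodicMeasure.ae_eq_const_of_markovL2_eq (hμe : IsErgodicMeasure κ μ)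
    (hμ : μ.bind κ = μ) {F : Lp ℝ 2 μ} (hF : markovL2 hμ F = F) :
    ∃ c : ℝ, F =ᵐ[μ] fun _ => c := by
  refine hμe.ae_eq_const (Lp.stronglyMeasurable F).measurable ?_
  have hfst := measurePreserving_fst_compProd (κ := κ) (μ := μ)
  have hsnd := measurePreserving_snd_compProd hμ
  have heq : Lp.compMeasurePreserving Prod.fst hfst F = Lp.compMeasurePreserving Prod.snd hsnd F := by
    rw [← sub_eq_zero, ← norm_eq_zero, ← sq_eq_zero_iff, norm_sub_sq_real, ← inner_markovL2 hμ, hF,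
      Lp.norm_compMeasurePreserving, Lp.norm_compMeasurePreserving, real_inner_self_eq_norm_sq]
    ring
  have h₁ := Lp.coeFn_compMeasurePreserving F hfst
  rw [heq] at h₁
  filter_upwards [h₁, Lp.coeFn_compMeasurePreserving F hsnd] with p h₁ h₂
  exact h₁.symm.trans h₂

/-- Correlations of a centered observable vanish in the Cesàro sense. -/
lemma IsErgodicMeasure.tendsto_average_correlation (hμe : IsErgodicMeasure κ μ)
    (hμ : μ.bind κ = μ) (hg : IsBddMeas g) (hg₀ : ∫ x, g x ∂μ = 0) :
    Tendsto (fun n : ℕ => (n : ℝ)⁻¹ *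
      ∑ m ∈ Finset.range n, ∫ x, g x * (markovOp κ)^[m] g x ∂μ) atTop (𝓝 0) := by
  set G := (hg.memLp 2 μ).toLp g with hG
  have hproj : ((markovL2 hμ).eqLocus
      (1 : Lp ℝ 2 μ →L[ℝ] Lp ℝ 2 μ)).orthogonalProjectionOnto G = 0 := by
    rw [Submodule.orthogonalProjectionOnto_eq_zero_iff, Submodule.mem_orthogonal]
    intro F hF
    obtain ⟨c, hc⟩ := hμe.ae_eq_const_of_markovL2_eq hμ hF
    rw [L2.inner_def]
    calc _ = ∫ x, c * g x ∂μ := by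
          refine integral_congr_ae ?_
          filter_upwards [hc, (hg.memLp 2 μ).coeFn_toLp] with x h₁ h₂
          simp only [RCLike.inner_apply, conj_trivial, h₁, hG, h₂, mul_comm]
      _ = 0 := by rw [integral_const_mul, hg₀, mul_zero]
  have hlim := (markovL2 hμ).tendsto_birkhoffAverage_orthogonalProjection (norm_markovL2_le hμ) G
  rw [hproj] at hlim
  have := (tendsto_const_nhds (x := G)).inner (𝕜 := ℝ) hlim
  simp only [ZeroMemClass.coe_zero, inner_zero_right] at this
  refine this.congr fun n => ?_
  simp only [birkhoffAverage, birkhoffSum, real_inner_smul_right, inner_sum, id]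
  congr 1
  refine Finset.sum_congr rfl fun m _ => ?_
  rw [hG, iterate_markovL2_toLp hμ hg, inner_toLp_toLp]

lemma tendsto_div_sq_of_increment {a b : ℕ → ℝ} (h₀ : a 0 = 0) (ha : ∀ n, 0 ≤ a n)
    (hab : ∀ n, a (n + 1) = a n + b n)
    (hb : Tendsto (fun n : ℕ => ((n + 1 : ℕ) : ℝ)⁻¹ * b n) atTop (𝓝 0)) :
    Tendsto (fun n : ℕ => a n / (n : ℝ) ^ 2) atTop (𝓝 0) := by
  have hsum (n : ℕ) : a n = ∑ i ∈ Finset.range n, b i := by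
    induction n with
    | zero => simpa using h₀
    | succ n ih => rw [hab, ih, Finset.sum_range_succ]
  have hces := hb.abs.cesaro
  rw [abs_zero] at hces
  refine squeeze_zero (fun n => by have := ha n; positivity) (fun n => ?_) hces
  rcases n.eq_zero_or_pos with rfl | hn
  · simp
  have hn' : (0 : ℝ) < n := by exact_mod_cast hn
  have hle : a n ≤ n * ∑ i ∈ Finset.range n, |((i + 1 : ℕ) : ℝ)⁻¹ * b i| := by
    rw [hsum, Finset.mul_sum]
    refine Finset.sum_le_sum fun i hi => (le_abs_self _).trans ?_
    have hi' : ((i + 1 : ℕ) : ℝ) ≤ n := by exact_mod_cast Finset.mem_range.1 hi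
    have hpos : (0 : ℝ) < ((i + 1 : ℕ) : ℝ) := by positivity
    calc |b i| = ((i + 1 : ℕ) : ℝ) * |((i + 1 : ℕ) : ℝ)⁻¹ * b i| := by
          rw [abs_mul, abs_of_pos (inv_pos.2 hpos), mul_inv_cancel_left₀ hpos.ne']
      _ ≤ n * |((i + 1 : ℕ) : ℝ)⁻¹ * b i| := mul_le_mul_of_nonneg_right hi' (abs_nonneg _)
  rw [div_le_iff₀ (by positivity)]
  calc a n ≤ n * ∑ i ∈ Finset.range n, |((i + 1 : ℕ) : ℝ)⁻¹ * b i| := hle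
    _ = _ := by field_simp

lemma IsErgodicMeasure.tendsto_integral_secondMoment (hμe : IsErgodicMeasure κ μ)
    (hμ : μ.bind κ = μ) (hg : IsBddMeas g) (hg₀ : ∫ x, g x ∂μ = 0)
    (hnonneg : ∀ n x, 0 ≤ secondMoment κ g n x) :
    Tendsto (fun n : ℕ => ∫ x, secondMoment κ g n x / (n : ℝ) ^ 2 ∂μ) atTop (𝓝 0) := by
  simp_rw [integral_div]
  refine tendsto_div_sq_of_increment (by simp [secondMoment])
    (fun n => integral_nonneg (hnonneg n)) (integral_secondMoment_succ hμ hg) ?_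
  have h₁ := ((hμe.tendsto_average_correlation hμ hg hg₀).comp (tendsto_add_atTop_nat 1)).const_mul 2
  have h₂ := ((tendsto_inv_atTop_nhds_zero_nat (𝕜 := ℝ)).comp
    (tendsto_add_atTop_nat 1)).mul_const (∫ x, g x * g x ∂μ)
  convert h₁.sub h₂ using 1
  · ext n
    simp only [Function.comp_apply]
    ring
  · simp

end MeanErgodic

section Uniqueness

variable {X : Type*} [MeasurableSpace X] {κ : Kernel X X} [IsMarkovKernel κ]
  {μ : Measure X} [IsProbabilityMeasure μ] {g : X → ℝ}

lemma IsMarkovLaw.exists_subseq_average_tendsto {ν : Measure (ℕ → X)} [IsProbabilityMeasure ν]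
    {x : X} (hν : IsMarkovLaw κ ν) (hν₀ : ν.map (fun ω => ω 0) = Measure.dirac x)
    (hg : IsBddMeas g) {ks : ℕ → ℕ}
    (hlim : Tendsto (fun i => secondMoment κ g (ks i) x / (ks i : ℝ) ^ 2) atTop (𝓝 0)) :
    ∃ ns : ℕ → ℕ, StrictMono ns ∧ ∀ᵐ ω ∂ν, Tendsto (fun i =>
      (ks (ns i) : ℝ)⁻¹ * ∑ k ∈ Finset.range (ks (ns i)), g (ω k)) atTop (𝓝 0) := by
  let φ (i : ℕ) (ω : ℕ → X) : ℝ := ((ks i : ℝ)⁻¹ * ∑ k ∈ Finset.range (ks i), g (ω k)) ^ 2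
  have hφ (i : ℕ) : IsBddMeas (φ i) := by
    have := (IsBddMeas.const (X := ℕ → X) (ks i : ℝ)⁻¹).mul (hg.pathSum (ks i))
    simpa only [φ, pow_two] using this.mul this
  have hφlim : Tendsto (fun i => ∫ ω, φ i ω ∂ν) atTop (𝓝 0) := by
    refine hlim.congr fun i => ?_
    simp only [φ, mul_pow]
    rw [integral_const_mul, hν.integral_sum_sq hν₀ hg]
    ring
  obtain ⟨ns, hns, hae⟩ := exists_subseq_tendsto_ae (fun i => (hφ i).integrable ν)
    (fun i ω => sq_nonneg _) hφlim
  refine ⟨ns, hns, hae.mono fun ω hω => ?_⟩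
  rw [tendsto_zero_iff_abs_tendsto_zero]
  simpa [φ, Real.sqrt_sq_eq_abs, Function.comp_def] using hω.sqrt

lemma IsErgodicMeasure.exists_subseq_secondMoment_tendsto (hμe : IsErgodicMeasure κ μ)
    (hμ : μ.bind κ = μ) (hg : IsBddMeas g) (hg₀ : ∫ x, g x ∂μ = 0)
    (hnonneg : ∀ n x, 0 ≤ secondMoment κ g n x) {ks : ℕ → ℕ} (hks : Tendsto ks atTop atTop) :
    ∃ ns : ℕ → ℕ, StrictMono ns ∧ ∀ᵐ x ∂μ, Tendsto (fun i =>
      secondMoment κ g (ks (ns i)) x / (ks (ns i) : ℝ) ^ 2) atTop (𝓝 0) := by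
  refine exists_subseq_tendsto_ae
    (φ := fun i x => secondMoment κ g (ks i) x / (ks i : ℝ) ^ 2) (fun i => ?_) (fun i x => ?_)
    ((hμe.tendsto_integral_secondMoment hμ hg hg₀ hnonneg).comp hks)
  · exact ((hg.secondMoment (κ := κ) (ks i)).integrable μ).div_const _
  · exact div_nonneg (hnonneg _ x) (sq_nonneg _)

/-- If along some pair of trajectories of full-measure sets the observable `f` merges, then the two
ergodic averages of `f` agree. -/
lemma IsErgodicMeasure.integral_eq_of_merging {μ₁ μ₂ : Measure X}
    [IsProbabilityMeasure μ₁] [IsProbabilityMeasure μ₂] {law : X → Measure (ℕ → X)}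
    [∀ x, IsProbabilityMeasure (law x)] (hlaw : ∀ x, IsMarkovLaw κ (law x))
    (hlaw₀ : ∀ x, (law x).map (fun ω => ω 0) = Measure.dirac x)
    (h₁e : IsErgodicMeasure κ μ₁) (h₂e : IsErgodicMeasure κ μ₂)
    (h₁ : μ₁.bind κ = μ₁) (h₂ : μ₂.bind κ = μ₂) {f : X → ℝ} (hf : IsBddMeas f)
    (hmerge : ∀ x y, ∀ P Q : (ℕ → X) → Prop, (∀ᵐ ω ∂law x, P ω) → (∀ᵐ ω ∂law y, Q ω) →
      ∃ u v, P u ∧ Q v ∧ Tendsto (fun n => f (u n) - f (v n)) atTop (𝓝 0)) :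
    ∫ x, f x ∂μ₁ = ∫ x, f x ∂μ₂ := by
  set c₁ := ∫ x, f x ∂μ₁ with hc₁
  set c₂ := ∫ x, f x ∂μ₂ with hc₂
  have hg (c : ℝ) : IsBddMeas fun x => f x + -c := hf.add (IsBddMeas.const (-c))
  have hnonneg (c : ℝ) (n : ℕ) (x : X) : 0 ≤ secondMoment κ (fun x => f x + -c) n x := by
    rw [← (hlaw x).integral_sum_sq (hlaw₀ x) (hg c)]
    exact integral_nonneg fun _ => sq_nonneg _
  have hzero₁ : ∫ x, f x + -c₁ ∂μ₁ = 0 := by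
    rw [integral_add (hf.integrable _) (integrable_const _)]
    simp [← hc₁]
  have hzero₂ : ∫ x, f x + -c₂ ∂μ₂ = 0 := by
    rw [integral_add (hf.integrable _) (integrable_const _)]
    simp [← hc₂]
  obtain ⟨k₁, hk₁, hx⟩ := h₁e.exists_subseq_secondMoment_tendsto h₁ (hg c₁) hzero₁ (hnonneg c₁)
    tendsto_id
  obtain ⟨k₂, hk₂, hy⟩ := h₂e.exists_subseq_secondMoment_tendsto h₂ (hg c₂) hzero₂ (hnonneg c₂)
    hk₁.tendsto_atTop
  obtain ⟨x, hx⟩ := hx.exists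
  obtain ⟨y, hy⟩ := hy.exists
  obtain ⟨k₃, hk₃, hu⟩ := (hlaw x).exists_subseq_average_tendsto (hlaw₀ x) (hg c₁)
    (hx.comp hk₂.tendsto_atTop)
  obtain ⟨k₄, hk₄, hv⟩ := (hlaw y).exists_subseq_average_tendsto (hlaw₀ y) (hg c₂)
    (hy.comp hk₃.tendsto_atTop)
  obtain ⟨u, v, hu, hv, huv⟩ := hmerge x y _ _ hu hv
  have hK : Tendsto (fun i => k₁ (k₂ (k₃ (k₄ i)))) atTop atTop :=
    (hk₁.comp (hk₂.comp (hk₃.comp hk₄))).tendsto_atTop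
  have hdiff := ((hu.comp hk₄.tendsto_atTop).sub hv).sub (huv.cesaro.comp hK)
  have hconst : Tendsto (fun _ : ℕ => c₂ - c₁) atTop (𝓝 (0 - 0 - 0)) := by
    refine hdiff.congr' ?_
    filter_upwards [hK.eventually_gt_atTop 0] with i hi
    have hi' : ((k₁ (k₂ (k₃ (k₄ i))) : ℕ) : ℝ) ≠ 0 := by exact_mod_cast hi.ne'
    simp only [Function.comp_apply, id, Finset.sum_add_distrib, Finset.sum_sub_distrib,
      Finset.sum_const, Finset.card_range, nsmul_eq_mul]
    field_simp
    ring
  have := tendsto_nhds_unique hconst tendsto_const_nhds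
  linarith

/-- Probability measures agree if they have the same integrals of bounded Lipschitz functions. -/
lemma measure_eq_of_forall_lipschitz_integral_eq {Y : Type*} [MeasurableSpace Y]
    [PseudoEMetricSpace Y] [BorelSpace Y] {μ₁ μ₂ : Measure Y}
    [h₁ : IsProbabilityMeasure μ₁] [h₂ : IsProbabilityMeasure μ₂]
    (h : ∀ f : Y → ℝ, (∃ C, ∀ x y, dist (f x) (f y) ≤ C) → (∃ L, LipschitzWith L f) →
      ∫ x, f x ∂μ₁ = ∫ x, f x ∂μ₂) : μ₁ = μ₂ := by
  let ν₁ : ProbabilityMeasure Y := ⟨μ₁, h₁⟩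
  let ν₂ : ProbabilityMeasure Y := ⟨μ₂, h₂⟩
  have : Tendsto (fun _ : ℕ => ν₁) atTop (𝓝 ν₂) := by
    rw [tendsto_iff_forall_lipschitz_integral_tendsto]
    intro f hfb hfl
    exact tendsto_const_nhds_iff.2 (h f hfb hfl)
  exact congrArg ProbabilityMeasure.toMeasure (tendsto_nhds_unique tendsto_const_nhds this)

end Uniqueness

end GeneralizedCoupling

/-- If for any pair of initial conditions `x, y ∈ H` there
is a generalized coupling `ξ ∈ Ĉ(ℙ_x, ℙ_y)` giving positive mass to the
event `‖u(n) − v(n)‖_H → 0`, then the Markov chain has at most one ergodic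
invariant probability measure on `H`. -/
theorem generalized_coupling_uniqueness
    (H : Type*) [NormedAddCommGroup H] [InnerProductSpace ℝ H] [CompleteSpace H]
    [SecondCountableTopology H] [MeasurableSpace H] [BorelSpace H]
    (κ : Kernel H H) (hκ : IsMarkovKernel κ)
    (law : H → Measure (ℕ → H))
    (hlaw_prob : ∀ x, IsProbabilityMeasure (law x))
    -- `law x` is the law of the chain started at `x`:
    (hlaw_zero : ∀ x : H, Measure.map (fun ω => ω 0) (law x) = Measure.dirac x)
    -- Markov property: given the past up to time `n`, the next state has law
    -- `κ` applied to the current state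
    (hlaw_markov : ∀ (x : H) (n : ℕ),
      Measure.map (fun ω => (fun i : Fin (n + 1) => ω i, ω (n + 1))) (law x) =
        (Measure.map (fun ω (i : Fin (n + 1)) => ω i) (law x)) ⊗ₘ
          (κ.comap (fun v : Fin (n + 1) → H => v (Fin.last n))
            (measurable_pi_apply _)))
    -- the generalized coupling hypothesis
    (hcoupling : ∀ x y : H, ∃ ξ : Measure ((ℕ → H) × (ℕ → H)),
      IsProbabilityMeasure ξ ∧
      ξ.map Prod.fst ≪ law x ∧ ξ.map Prod.snd ≪ law y ∧
      0 < ξ {p | Tendsto (fun n => ‖p.1 n - p.2 n‖) atTop (𝓝 0)}) :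
    -- at most one ergodic invariant probability measure
    ∀ μ₁ μ₂ : Measure H, IsProbabilityMeasure μ₁ → IsProbabilityMeasure μ₂ →
      μ₁.bind κ = μ₁ → μ₂.bind κ = μ₂ →
      (∀ A : Set H, MeasurableSet A → (∀ᵐ x ∂μ₁, x ∈ A → κ x A = 1) →
        μ₁ A = 0 ∨ μ₁ A = 1) →
      (∀ A : Set H, MeasurableSet A → (∀ᵐ x ∂μ₂, x ∈ A → κ x A = 1) →
        μ₂ A = 0 ∨ μ₂ A = 1) →
      μ₁ = μ₂ := by
  intro μ₁ μ₂ _ _ h₁ h₂ h₁e h₂e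
  refine GeneralizedCoupling.measure_eq_of_forall_lipschitz_integral_eq fun f hfb hfl => ?_
  obtain ⟨C, hC⟩ := hfb
  obtain ⟨L, hL⟩ := hfl
  have hf : GeneralizedCoupling.IsBddMeas f := by
    refine ⟨hL.continuous.measurable, C + |f 0|, fun x => ?_⟩
    have := abs_add_le (f x - f 0) (f 0)
    rw [sub_add_cancel] at this
    exact this.trans (add_le_add_left (hC x 0) _)
  refine GeneralizedCoupling.IsErgodicMeasure.integral_eq_of_merging hlaw_markov hlaw_zero
    h₁e h₂e h₁ h₂ hf fun x y P Q hP hQ => ?_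
  obtain ⟨ξ, -, hξ₁, hξ₂, hξ⟩ := hcoupling x y
  have hP' := ae_of_ae_map measurable_fst.aemeasurable (hξ₁.ae_le hP)
  have hQ' := ae_of_ae_map measurable_snd.aemeasurable (hξ₂.ae_le hQ)
  have hfreq : ∃ᵐ p ∂ξ, Tendsto (fun n => ‖p.1 n - p.2 n‖) atTop (𝓝 0) :=
    frequently_ae_iff.2 hξ.ne'
  obtain ⟨p, hlim, hp, hq⟩ := (hfreq.and_eventually (hP'.and hQ')).exists
  refine ⟨p.1, p.2, hp, hq, squeeze_zero_norm (fun n => ?_)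
    (by simpa using hlim.const_mul (L : ℝ))⟩
  simpa [dist_eq_norm] using hL.dist_le_mul (p.1 n) (p.2 n)
end

section
/- Suppose the Markov transition semigroup associated with the stochastic Navier–Stokes equation is Feller on H, and suppose that for any x, x̃ ∈ H there exists a generalized coupling ξ = ξ_{x,x̃} ∈ Ĉ(ℙ_x, ℙ_{x̃}) such that π₁(ξ) is equivalent to ℙ_x and, for every ε > 0, lim_{n→∞} ξ({(u, ũ) ∈ H^ℕ × H^ℕ : ‖u(n) − ũ(n)‖_H ≤ ε}) = 1. Then there exists at most one invariant probability measure μ, and for every initial condition u₀ ∈ H the laws ℒ(u(n;u₀)) converge weakly to μ as n → ∞. -/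
/-!
STATEMENT 18 (Kulik–Scheutzow type criterion).  The solution of the
stochastic Navier–Stokes equation evaluated at integer times is a Markov
chain on the separable Hilbert space `H`, with one-step transition kernel
`κ` (the time-one Markov semigroup of the equation) and path laws
`law x = ℙ_x` on `H^ℕ`; the `n`-step law `ℒ(u(n;u₀))` is the image of
`ℙ_{u₀}` under `ω ↦ ω n`.  Generalized couplings are probability measures on
`H^ℕ × H^ℕ` with marginals absolutely continuous w.r.t. the path laws; two
measures are equivalent if each is absolutely continuous w.r.t. the other.
-/

open MeasureTheory ProbabilityTheory Filter
open scoped ENNReal Topology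

/-- The `ε`-`δ` form of absolute continuity of a finite measure. -/
lemma exists_pos_measureReal_lt_of_absolutelyContinuous {α : Type*} [MeasurableSpace α]
    {μ ν : Measure α} [IsFiniteMeasure μ] [IsFiniteMeasure ν] (h : μ ≪ ν) {ε : ℝ} (hε : 0 < ε) :
    ∃ δ > 0, ∀ s, ν.real s < δ → μ.real s < ε := by
  obtain ⟨δ, hδ, H⟩ := exists_pos_setLIntegral_lt_of_measure_lt (μ := ν) (f := μ.rnDeriv ν)
    (Measure.lintegral_rnDeriv_lt_top μ ν).ne (ε := ENNReal.ofReal ε) (by simpa using hε)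
  have key : ∀ s, ν s < δ → μ.real s < ε := fun s hs => by
    have h1 := H s hs
    rw [Measure.setLIntegral_rnDeriv h] at h1
    rw [Measure.real]
    exact (ENNReal.lt_ofReal_iff_toReal_lt (measure_ne_top μ s)).1 h1
  rcases eq_or_ne δ ⊤ with rfl | hδt
  · exact ⟨1, one_pos, fun s _ => key s (measure_lt_top ν s)⟩
  · refine ⟨δ.toReal, ENNReal.toReal_pos hδ.ne' hδt, fun s hs => key s ?_⟩
    exact (ENNReal.toReal_lt_toReal (measure_ne_top ν s) hδt).1 hs

lemma setOf_frequently_mem_eq_iInter_iUnion {α : Type*} (s : ℕ → Set α) :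
    {y | ∃ᶠ n in atTop, y ∈ s n} = ⋂ m, ⋃ n ≥ m, s n := by
  ext y
  simp [frequently_atTop]

/-- If infinitely many of the sets `s n` have measure at least `c`, so does their limsup. -/
lemma le_measureReal_frequently_mem {α : Type*} [MeasurableSpace α] {μ : Measure α}
    [IsFiniteMeasure μ] {s : ℕ → Set α} (hs : ∀ n, MeasurableSet (s n)) {c : ℝ}
    (hc : ∃ᶠ n in atTop, c ≤ μ.real (s n)) :
    c ≤ μ.real {y | ∃ᶠ n in atTop, y ∈ s n} := by
  have hmeas : ∀ m, MeasurableSet (⋃ n ≥ m, s n) := fun m =>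
    MeasurableSet.iUnion fun n => MeasurableSet.iUnion fun _ => hs n
  have hanti : Antitone fun m => ⋃ n ≥ m, s n := fun a b hab =>
    Set.biUnion_mono (fun n (hn : b ≤ n) => hab.trans hn) fun _ _ => subset_rfl
  have hlim := tendsto_measure_iInter_atTop (μ := μ) (fun m => (hmeas m).nullMeasurableSet)
    hanti ⟨0, measure_ne_top μ _⟩
  rw [setOf_frequently_mem_eq_iInter_iUnion]
  refine ge_of_tendsto ((ENNReal.tendsto_toReal (measure_ne_top μ _)).comp hlim)
    (Eventually.of_forall fun m => ?_)
  obtain ⟨n, hn, hcn⟩ := frequently_atTop.1 hc m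
  exact hcn.trans (measureReal_mono (Set.subset_iUnion₂_of_subset n hn subset_rfl)
    (measure_ne_top μ _))

lemma measurableSet_frequently_mem {α : Type*} [MeasurableSpace α] {s : ℕ → Set α}
    (hs : ∀ n, MeasurableSet (s n)) : MeasurableSet {y | ∃ᶠ n in atTop, y ∈ s n} := by
  rw [setOf_frequently_mem_eq_iInter_iUnion]
  exact MeasurableSet.iInter fun m => MeasurableSet.iUnion fun n =>
    MeasurableSet.iUnion fun _ => hs n

lemma integrable_of_abs_le {α : Type*} [MeasurableSpace α] {μ : Measure α} [IsFiniteMeasure μ]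
    {f : α → ℝ} (hf : Measurable f) {M : ℝ} (hM : ∀ y, |f y| ≤ M) : Integrable f μ :=
  Integrable.of_bound hf.aestronglyMeasurable M (Eventually.of_forall hM)

lemma abs_integral_le_of_abs_le {α : Type*} [MeasurableSpace α] {μ : Measure α}
    [IsProbabilityMeasure μ] {f : α → ℝ} {M : ℝ} (hM : ∀ y, |f y| ≤ M) : |∫ y, f y ∂μ| ≤ M := by
  simpa using norm_integral_le_of_norm_le_const (μ := μ) (f := f) (C := M) (Eventually.of_forall hM)

/-- The mean of a bounded function is at most `r` plus its bound times the mass of `{r ≤ |f|}`. -/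
lemma abs_integral_le_add_mul_measureReal {α : Type*} [MeasurableSpace α] {μ : Measure α}
    [IsProbabilityMeasure μ] {f : α → ℝ} (hf : Measurable f) {M r : ℝ} (hr : 0 ≤ r)
    (hM : ∀ y, |f y| ≤ M) : |∫ y, f y ∂μ| ≤ r + M * μ.real {y | r ≤ |f y|} := by
  have hs : MeasurableSet {y | r ≤ |f y|} := measurableSet_le measurable_const hf.abs
  have hi : Integrable ({y | r ≤ |f y|}.indicator fun _ => M) μ :=
    (integrable_const M).indicator hs
  calc |∫ y, f y ∂μ| ≤ ∫ y, |f y| ∂μ := abs_integral_le_integral_abs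
    _ ≤ ∫ y, (r + {y | r ≤ |f y|}.indicator (fun _ => M) y) ∂μ := by
        refine integral_mono (integrable_of_abs_le hf hM).abs ((integrable_const r).add hi)
          fun y => ?_
        by_cases hy : r ≤ |f y|
        · simpa [Set.indicator, hy] using (hM y).trans (by linarith)
        · simpa [Set.indicator, hy] using (not_le.1 hy).le
    _ = r + M * μ.real {y | r ≤ |f y|} := by
        rw [integral_add (integrable_const r) hi, integral_indicator_const _ hs]
        simp [mul_comm]

instance isMarkovKernel_pow {E : Type*} [MeasurableSpace E] (κ : Kernel E E) [IsMarkovKernel κ]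
    (n : ℕ) : IsMarkovKernel (κ ^ n) := by
  induction n with
  | zero => exact inferInstanceAs (IsMarkovKernel Kernel.id)
  | succ n ih => exact inferInstanceAs (IsMarkovKernel ((κ ^ n) ∘ₖ κ))

lemma bind_pow_eq_self {E : Type*} [MeasurableSpace E] {κ : Kernel E E} {μ : Measure E}
    (h : μ.bind κ = μ) (n : ℕ) : μ.bind (κ ^ n) = μ := by
  induction n with
  | zero => exact Measure.bind_dirac
  | succ n ih =>
    have : κ ^ (n + 1) = (κ ^ n) ∘ₖ κ := rfl
    rw [this, ← Measure.comp_assoc, h, ih]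

lemma integral_integral_of_bind_eq {E : Type*} [MeasurableSpace E] {κ : Kernel E E}
    {μ : Measure E} (h : μ.bind κ = μ) {f : E → ℝ} (hf : Integrable f μ) :
    ∫ y, ∫ z, f z ∂(κ y) ∂μ = ∫ z, f z ∂μ := by
  have h' : (κ ∘ₖ Kernel.const Unit μ) () = μ := by
    rw [← Measure.comp_eq_comp_const_apply, h]
  have := Kernel.integral_comp (η := κ) (κ := Kernel.const Unit μ) (a := ()) (f := f)
    (by rwa [h'])
  rw [h'] at this
  simpa using this.symm

lemma integral_pow_add {E : Type*} [MeasurableSpace E] (κ : Kernel E E) [IsMarkovKernel κ]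
    {φ : E → ℝ} (hφ : Measurable φ) {M : ℝ} (hM : ∀ y, |φ y| ≤ M) (n m : ℕ) (y : E) :
    ∫ z, φ z ∂((κ ^ (n + m)) y) = ∫ w, ∫ z, φ z ∂((κ ^ m) w) ∂((κ ^ n) y) := by
  have : κ ^ (n + m) = (κ ^ m) ∘ₖ (κ ^ n) := by rw [add_comm, Kernel.pow_add]
  rw [this]
  exact Kernel.integral_comp (integrable_of_abs_le hφ hM)

lemma measurable_integral_kernel {E : Type*} [MeasurableSpace E] (κ : Kernel E E)
    [IsMarkovKernel κ] {φ : E → ℝ} (hφ : Measurable φ) :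
    Measurable fun y => ∫ z, φ z ∂(κ y) :=
  (hφ.stronglyMeasurable.integral_kernel (κ := κ)).measurable

/-- Powers of a Feller kernel are Feller. -/
lemma continuous_integral_pow {E : Type*} [MeasurableSpace E] [TopologicalSpace E]
    [OpensMeasurableSpace E] {κ : Kernel E E} [IsMarkovKernel κ]
    (hF : ∀ φ : E → ℝ, Continuous φ → (∃ M, ∀ y, |φ y| ≤ M) →
      Continuous fun x => ∫ y, φ y ∂(κ x))
    {φ : E → ℝ} (hφ : Continuous φ) {M : ℝ} (hM : ∀ y, |φ y| ≤ M) (n : ℕ) :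
    Continuous fun x => ∫ y, φ y ∂((κ ^ n) x) := by
  induction n with
  | zero =>
    have : (fun x => ∫ y, φ y ∂((κ ^ 0) x)) = φ := by
      funext x
      change ∫ y, φ y ∂(Kernel.id x) = φ x
      rw [Kernel.id_apply, integral_dirac' _ _ hφ.measurable.stronglyMeasurable]
    rwa [this]
  | succ n ih =>
    have : (fun x => ∫ y, φ y ∂((κ ^ (n + 1)) x)) =
        fun x => ∫ w, ∫ y, φ y ∂((κ ^ n) w) ∂(κ x) := by
      funext x
      rw [add_comm n 1, integral_pow_add κ hφ.measurable hM 1 n x, pow_one]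
    rw [this]
    exact hF _ ih ⟨M, fun w => abs_integral_le_of_abs_le hM⟩

/-- The variance of a function under a probability measure, as the mean squared deviation. -/
lemma integral_sub_integral_sq {α : Type*} [MeasurableSpace α] {μ : Measure α}
    [IsProbabilityMeasure μ] {f : α → ℝ} (hf : Measurable f) {M : ℝ} (hM : ∀ y, |f y| ≤ M) :
    ∫ z, (f z - ∫ w, f w ∂μ) ^ 2 ∂μ = ∫ z, f z ^ 2 ∂μ - (∫ z, f z ∂μ) ^ 2 := by
  have h1 : Integrable f μ := integrable_of_abs_le hf hM
  have h2 : Integrable (fun z => f z ^ 2) μ := by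
    refine integrable_of_abs_le (hf.pow_const 2) (M := M ^ 2) fun y => ?_
    rw [abs_pow]
    exact pow_le_pow_left₀ (abs_nonneg _) (hM y) 2
  set c := ∫ w, f w ∂μ with hc
  have : (fun z => (f z - c) ^ 2) = fun z => (f z ^ 2 - (2 * c) * f z) + c ^ 2 := by
    funext z; ring
  have h3 : Integrable (fun z => f z ^ 2 - 2 * c * f z) μ := h2.sub (h1.const_mul _)
  rw [this, integral_add h3 (integrable_const _), integral_sub h2 (h1.const_mul _),
    integral_const_mul, ← hc]
  simp
  ring

/-- Under an invariant measure, the variance of `P^L φ` under `κ ^ n` is uniformly small in `n`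
once `L` is large. -/
lemma exists_integral_deviation_le {E : Type*} [MeasurableSpace E] {κ : Kernel E E}
    [IsMarkovKernel κ] {μ : Measure E} [IsProbabilityMeasure μ] (hμ : μ.bind κ = μ)
    {φ : E → ℝ} (hφ : Measurable φ) {M : ℝ} (hM : ∀ y, |φ y| ≤ M) {ε : ℝ} (hε : 0 < ε) :
    ∃ L : ℕ, ∀ n : ℕ,
      Integrable (fun y => ∫ z, (∫ w, φ w ∂((κ ^ L) z) - ∫ w, φ w ∂((κ ^ (n + L)) y)) ^ 2
        ∂((κ ^ n) y)) μ ∧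
      ∫ y, ∫ z, (∫ w, φ w ∂((κ ^ L) z) - ∫ w, φ w ∂((κ ^ (n + L)) y)) ^ 2
        ∂((κ ^ n) y) ∂μ ≤ ε := by
  set F : ℕ → E → ℝ := fun n y => ∫ w, φ w ∂((κ ^ n) y) with hFdef
  have hFm : ∀ n, Measurable (F n) := fun n => measurable_integral_kernel (κ ^ n) hφ
  have hFb : ∀ n y, |F n y| ≤ M := fun n y => abs_integral_le_of_abs_le hM
  have hsq : ∀ n y, |F n y ^ 2| ≤ M ^ 2 := fun n y => by
    rw [abs_pow]; exact pow_le_pow_left₀ (abs_nonneg _) (hFb n y) 2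
  have hadd : ∀ n L y, F (n + L) y = ∫ z, F L z ∂((κ ^ n) y) := fun n L y =>
    integral_pow_add κ hφ hM n L y
  have hvar : ∀ n L y, ∫ z, (F L z - F (n + L) y) ^ 2 ∂((κ ^ n) y) =
      ∫ z, F L z ^ 2 ∂((κ ^ n) y) - F (n + L) y ^ 2 := fun n L y => by
    rw [hadd]; exact integral_sub_integral_sq (hFm L) (hFb L)
  have hi1 : ∀ n L, Integrable (fun y => ∫ z, F L z ^ 2 ∂((κ ^ n) y)) μ := fun n L =>
    integrable_of_abs_le (measurable_integral_kernel (κ ^ n) ((hFm L).pow_const 2))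
      fun y => abs_integral_le_of_abs_le (hsq L)
  have hi2 : ∀ n, Integrable (fun y => F n y ^ 2) μ := fun n =>
    integrable_of_abs_le ((hFm n).pow_const 2) (hsq n)
  have hint : ∀ n L, ∫ y, ∫ z, (F L z - F (n + L) y) ^ 2 ∂((κ ^ n) y) ∂μ =
      ∫ y, F L y ^ 2 ∂μ - ∫ y, F (n + L) y ^ 2 ∂μ := fun n L => by
    simp_rw [hvar]
    rw [integral_sub (hi1 n L) (hi2 _),
      integral_integral_of_bind_eq (bind_pow_eq_self hμ n) (hi2 L)]
  have hanti : Antitone fun n => ∫ y, F n y ^ 2 ∂μ := by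
    refine antitone_nat_of_succ_le fun L => ?_
    have h0 : 0 ≤ ∫ y, ∫ z, (F L z - F (1 + L) y) ^ 2 ∂((κ ^ 1) y) ∂μ :=
      integral_nonneg fun y => integral_nonneg fun z => sq_nonneg _
    rw [hint, add_comm 1 L] at h0
    linarith
  have hbdd : BddBelow (Set.range fun n => ∫ y, F n y ^ 2 ∂μ) :=
    ⟨0, by rintro _ ⟨n, rfl⟩; exact integral_nonneg fun y => sq_nonneg _⟩
  have hlim := tendsto_atTop_ciInf hanti hbdd
  obtain ⟨L, hL⟩ := ((tendsto_order.1 hlim).2 _ (lt_add_of_pos_right _ hε)).exists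
  refine ⟨L, fun n => ⟨?_, ?_⟩⟩
  · change Integrable (fun y => ∫ z, (F L z - F (n + L) y) ^ 2 ∂((κ ^ n) y)) μ
    simp_rw [hvar]
    exact (hi1 n L).sub (hi2 _)
  · refine (hint n L).trans_le ?_
    have := ciInf_le hbdd (n + L)
    linarith

/-- Under an invariant measure, for most starting points `y` and with high probability, the chain
at time `n` lies in a compact set on which `P^L φ` is close to `P^(n + L) φ y`, uniformly in `n`. -/
lemma exists_measureReal_deviation_le {E : Type*} [MeasurableSpace E] [TopologicalSpace E]
    [T2Space E] [SecondCountableTopology E] [TopologicalSpace.IsCompletelyPseudoMetrizableSpace E]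
    [BorelSpace E] {κ : Kernel E E}
    [IsMarkovKernel κ] {μ : Measure E} [IsProbabilityMeasure μ] (hμ : μ.bind κ = μ)
    {φ : E → ℝ} (hφ : Measurable φ) {M : ℝ} (hM : ∀ y, |φ y| ≤ M) {ε : ℝ} (hε : 0 < ε) :
    ∃ (L : ℕ) (K : Set E), IsCompact K ∧ ∀ n : ℕ,
      MeasurableSet {y | ε ≤ ((κ ^ n) y).real
        {z | z ∉ K ∨ ε ≤ |∫ w, φ w ∂((κ ^ L) z) - ∫ w, φ w ∂((κ ^ (n + L)) y)|}} ∧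
      μ.real {y | ε ≤ ((κ ^ n) y).real
        {z | z ∉ K ∨ ε ≤ |∫ w, φ w ∂((κ ^ L) z) - ∫ w, φ w ∂((κ ^ (n + L)) y)|}} ≤ ε := by
  obtain ⟨L, hL⟩ := exists_integral_deviation_le hμ hφ hM (ε := ε ^ 4 / 2) (by positivity)
  obtain ⟨K, hK, hKμ⟩ := isTightMeasureSet_iff_exists_isCompact_measure_compl_le.1
    (isTightMeasureSet_singleton (μ := μ)) (ENNReal.ofReal (ε ^ 2 / 2))
    (by simp only [ENNReal.ofReal_pos]; positivity)
  have hKm : MeasurableSet Kᶜ := hK.isClosed.measurableSet.compl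
  have hKr : μ.real Kᶜ ≤ ε ^ 2 / 2 :=
    ENNReal.toReal_le_of_le_ofReal (by positivity) (hKμ μ rfl)
  refine ⟨L, K, hK, fun n => ?_⟩
  set F : ℕ → E → ℝ := fun n y => ∫ w, φ w ∂((κ ^ n) y) with hFdef
  have hFm : ∀ n, Measurable (F n) := fun n => measurable_integral_kernel (κ ^ n) hφ
  have hFb : ∀ n y, |F n y| ≤ M := fun n y => abs_integral_le_of_abs_le hM
  set D : E → ℝ := fun y => ∫ z, (F L z - F (n + L) y) ^ 2 ∂((κ ^ n) y) with hD
  set Q : E → ℝ := fun y => ((κ ^ n) y).real Kᶜ with hQ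
  have hbadm : MeasurableSet {p : E × E | p.2 ∉ K ∨ ε ≤ |F L p.2 - F (n + L) p.1|} :=
    (measurable_snd hKm).union (measurableSet_le measurable_const
      (((hFm L).comp measurable_snd).sub ((hFm (n + L)).comp measurable_fst)).abs)
  have hmeas : Measurable fun y =>
      ((κ ^ n) y).real {z | z ∉ K ∨ ε ≤ |F L z - F (n + L) y|} :=
    (Kernel.measurable_kernel_prodMk_left (κ := κ ^ n) hbadm).ennreal_toReal
  refine ⟨measurableSet_le measurable_const hmeas, ?_⟩
  have hQi : Integrable Q μ :=
    integrable_of_abs_le ((κ ^ n).measurable_coe hKm).ennreal_toReal (M := 1) fun y => by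
      rw [abs_of_nonneg measureReal_nonneg]; exact measureReal_le_one
  have hQint : ∫ y, Q y ∂μ = μ.real Kᶜ := by
    have := integral_integral_of_bind_eq (bind_pow_eq_self hμ n)
      (f := Kᶜ.indicator fun _ => (1 : ℝ)) ((integrable_const _).indicator hKm)
    simpa [integral_indicator_const _ hKm] using this
  have hDi : Integrable D μ := (hL n).1
  have hbound : ∀ y, ((κ ^ n) y).real {z | z ∉ K ∨ ε ≤ |F L z - F (n + L) y|} ≤
      Q y + D y / ε ^ 2 := fun y => by
    have hi : Integrable (fun z => (F L z - F (n + L) y) ^ 2) ((κ ^ n) y) := by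
      refine integrable_of_abs_le (((hFm L).sub_const _).pow_const 2) (M := (2 * M) ^ 2)
        fun z => ?_
      rw [abs_pow]
      refine pow_le_pow_left₀ (abs_nonneg _) ((abs_sub _ _).trans ?_) 2
      linarith [hFb L z, hFb (n + L) y]
    have hch := mul_meas_ge_le_integral_of_nonneg
      (Eventually.of_forall fun z => sq_nonneg (F L z - F (n + L) y)) hi (ε ^ 2)
    have hsub : {z | z ∉ K ∨ ε ≤ |F L z - F (n + L) y|} ⊆
        Kᶜ ∪ {z | ε ^ 2 ≤ (F L z - F (n + L) y) ^ 2} := by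
      rintro z (hz | hz)
      · exact Or.inl hz
      · refine Or.inr ?_
        have := pow_le_pow_left₀ hε.le hz 2
        rwa [sq_abs] at this
    refine (measureReal_mono hsub).trans ((measureReal_union_le _ _).trans ?_)
    have : ((κ ^ n) y).real {z | ε ^ 2 ≤ (F L z - F (n + L) y) ^ 2} ≤ D y / ε ^ 2 := by
      rw [le_div_iff₀ (by positivity), mul_comm]
      exact hch
    linarith
  have hI : ∫ y, (Q y + D y / ε ^ 2) ∂μ ≤ ε ^ 2 := by
    rw [integral_add hQi (hDi.div_const _), hQint, integral_div]
    have : (∫ y, D y ∂μ) / ε ^ 2 ≤ ε ^ 2 / 2 := by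
      rw [div_le_iff₀ (by positivity)]
      refine (hL n).2.trans (le_of_eq ?_)
      ring
    linarith
  have hnn : ∀ y, 0 ≤ Q y + D y / ε ^ 2 := fun y =>
    add_nonneg measureReal_nonneg
      (div_nonneg (integral_nonneg fun z => sq_nonneg _) (by positivity))
  have hch := mul_meas_ge_le_integral_of_nonneg (Eventually.of_forall hnn)
    (hQi.add (hDi.div_const _)) ε
  have hmono : μ.real {y | ε ≤ ((κ ^ n) y).real {z | z ∉ K ∨ ε ≤ |F L z - F (n + L) y|}} ≤
      μ.real {y | ε ≤ Q y + D y / ε ^ 2} :=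
    measureReal_mono fun y hy => le_trans hy (hbound y)
  refine hmono.trans ?_
  have h2 : ε * μ.real {y | ε ≤ Q y + D y / ε ^ 2} ≤ ε * ε := by
    refine le_trans hch (hI.trans (le_of_eq (sq ε)))
  exact le_of_mul_le_mul_left h2 hε

/-- A generalized coupling that brings the coordinates together transfers concentration of
`ψ (ω n)` from the second path law to the first. -/
lemma exists_transfer_of_generalized_coupling {E : Type*} [PseudoMetricSpace E] [T2Space E]
    [SecondCountableTopology E] [MeasurableSpace E] [BorelSpace E] {P₁ P₂ : Measure (ℕ → E)}
    [IsProbabilityMeasure P₁] [IsProbabilityMeasure P₂]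
    {ξ : Measure ((ℕ → E) × (ℕ → E))} [IsProbabilityMeasure ξ]
    (h₁ : P₁ ≪ ξ.map Prod.fst) (h₂ : ξ.map Prod.snd ≪ P₂)
    (hξ : ∀ ε : ℝ, 0 < ε → Tendsto (fun n => ξ {p | dist (p.1 n) (p.2 n) ≤ ε}) atTop (𝓝 1))
    {ε : ℝ} (hε : 0 < ε) :
    ∃ δ > 0, ∀ (K : Set E) (ψ : E → ℝ), IsCompact K → Continuous ψ → ∀ᶠ n in atTop, ∀ c : ℝ,
      P₂.real {ω | ω n ∉ K ∨ δ ≤ |ψ (ω n) - c|} < δ → P₁.real {ω | ε ≤ |ψ (ω n) - c|} < ε := by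
  have : IsProbabilityMeasure (ξ.map Prod.fst) :=
    Measure.isProbabilityMeasure_map measurable_fst.aemeasurable
  have : IsProbabilityMeasure (ξ.map Prod.snd) :=
    Measure.isProbabilityMeasure_map measurable_snd.aemeasurable
  obtain ⟨δ₁, hδ₁, H₁⟩ := exists_pos_measureReal_lt_of_absolutelyContinuous h₁ hε
  obtain ⟨δ₂, hδ₂, H₂⟩ := exists_pos_measureReal_lt_of_absolutelyContinuous h₂ (half_pos hδ₁)
  refine ⟨min (ε / 2) δ₂, lt_min (half_pos hε) hδ₂, fun K ψ hK hψ => ?_⟩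
  obtain ⟨η, hη, hηK⟩ : ∃ η > 0, ∀ z ∈ K, ∀ z', dist z' z ≤ η → |ψ z' - ψ z| < ε / 2 := by
    have := hK.uniformContinuousAt_of_continuousAt ψ (fun a _ => hψ.continuousAt)
      (Metric.dist_mem_uniformity (half_pos hε))
    obtain ⟨η, hη, hsub⟩ := Metric.mem_uniformity_dist.1 this
    refine ⟨η / 2, half_pos hη, fun z hz z' hzz' => ?_⟩
    have h := hsub (a := z) (b := z') (by rw [dist_comm]; linarith) hz
    rw [← Real.dist_eq, dist_comm]
    exact h
  have hlim : Tendsto (fun n => ξ.real {p | dist (p.1 n) (p.2 n) ≤ η}) atTop (𝓝 1) := by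
    simpa [Measure.real, Function.comp_def] using
      (ENNReal.tendsto_toReal ENNReal.one_ne_top).comp (hξ η hη)
  filter_upwards [(tendsto_order.1 hlim).1 (1 - δ₁ / 2) (by linarith)] with n hn c hc
  have hfst : Measurable fun p : (ℕ → E) × (ℕ → E) => p.1 n :=
    (measurable_pi_apply n).comp measurable_fst
  have hsnd : Measurable fun p : (ℕ → E) × (ℕ → E) => p.2 n :=
    (measurable_pi_apply n).comp measurable_snd
  have hclose : MeasurableSet {p : (ℕ → E) × (ℕ → E) | dist (p.1 n) (p.2 n) ≤ η} :=
    measurableSet_le (hfst.dist hsnd) measurable_const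
  have hfar : ξ.real {p | dist (p.1 n) (p.2 n) ≤ η}ᶜ < δ₁ / 2 := by
    rw [probReal_compl_eq_one_sub hclose]; linarith
  have hcoord : Measurable fun ω : ℕ → E => |ψ (ω n) - c| :=
    ((hψ.measurable.comp (measurable_pi_apply n)).sub_const c).abs
  have hout : MeasurableSet {ω : ℕ → E | ω n ∉ K} :=
    hK.isClosed.measurableSet.compl.preimage (measurable_pi_apply n)
  have hbad : MeasurableSet {ω : ℕ → E | ω n ∉ K ∨ min (ε / 2) δ₂ ≤ |ψ (ω n) - c|} :=
    hout.union (measurableSet_le measurable_const hcoord)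
  have hsec := H₂ _ (hc.trans_le (min_le_right _ _))
  rw [map_measureReal_apply measurable_snd hbad] at hsec
  refine H₁ _ ?_
  rw [map_measureReal_apply measurable_fst (measurableSet_le measurable_const hcoord)]
  refine lt_of_le_of_lt ((measureReal_mono ?_).trans (measureReal_union_le _ _))
    ((add_lt_add hsec hfar).trans_eq (add_halves δ₁))
  intro p hp
  by_contra hcon
  simp only [Set.mem_union, Set.mem_preimage, Set.mem_ofPred_eq, Set.mem_compl_iff, not_or,
    not_not, not_le] at hcon hp
  obtain ⟨⟨hpK, hpc⟩, hpd⟩ := hcon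
  have h1 := hηK _ hpK _ (not_lt.1 hpd)
  have h2 := hpc.trans_le (min_le_left _ _)
  have h3 := abs_sub_le (ψ (p.1 n)) (ψ (p.2 n)) c
  linarith

/-- The `n`-th marginal of the path law of a Markov chain is given by the `n`-step kernel. -/
lemma map_eval_eq_pow {E : Type*} [MeasurableSpace E] {κ : Kernel E E} [IsMarkovKernel κ]
    {P : Measure (ℕ → E)} [IsProbabilityMeasure P] {x : E}
    (h0 : P.map (fun ω => ω 0) = Measure.dirac x)
    (hstep : ∀ n : ℕ, P.map (fun ω => (fun i : Fin (n + 1) => ω i, ω (n + 1))) =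
      (P.map (fun ω (i : Fin (n + 1)) => ω i)) ⊗ₘ
        (κ.comap (fun v : Fin (n + 1) → E => v (Fin.last n)) (measurable_pi_apply _))) (n : ℕ) :
    P.map (fun ω => ω n) = (κ ^ n) x := by
  induction n with
  | zero => rw [h0]; exact (Kernel.id_apply x).symm
  | succ n ih =>
    have hpre : Measurable fun (ω : ℕ → E) (i : Fin (n + 1)) => ω i :=
      measurable_pi_lambda _ fun i => measurable_pi_apply _
    have : IsProbabilityMeasure (P.map fun (ω : ℕ → E) (i : Fin (n + 1)) => ω i) :=
      Measure.isProbabilityMeasure_map hpre.aemeasurable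
    have hl : P.map (fun ω => ω (n + 1)) =
        (P.map (fun ω => (fun i : Fin (n + 1) => ω i, ω (n + 1)))).snd := by
      rw [Measure.snd, Measure.map_map measurable_snd (hpre.prodMk (measurable_pi_apply _))]
      rfl
    rw [hl, hstep, Measure.snd_compProd]
    have hpow : κ ^ (n + 1) = κ ∘ₖ (κ ^ n) := pow_succ' κ n
    rw [hpow, Kernel.comp_apply, ← ih]
    ext s hs
    rw [Measure.bind_apply hs (Kernel.aemeasurable _),
      Measure.bind_apply hs (Kernel.aemeasurable _),
      lintegral_map (Kernel.measurable_coe _ hs) hpre,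
      lintegral_map (Kernel.measurable_coe _ hs) (measurable_pi_apply n)]
    rfl

/-- Weak convergence of the transition probabilities of a Feller chain to an invariant measure,
under concentration transfer between any two starting points. -/
lemma tendsto_integral_pow_of_transfer {E : Type*} [MeasurableSpace E] [TopologicalSpace E]
    [T2Space E] [SecondCountableTopology E] [TopologicalSpace.IsCompletelyPseudoMetrizableSpace E]
    [BorelSpace E] {κ : Kernel E E} [IsMarkovKernel κ]
    (hF : ∀ φ : E → ℝ, Continuous φ → (∃ M, ∀ y, |φ y| ≤ M) →
      Continuous fun x => ∫ y, φ y ∂(κ x))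
    {x : E} (htransfer : ∀ (y : E) (ε : ℝ), 0 < ε → ∃ δ > 0, ∀ (K : Set E) (ψ : E → ℝ),
      IsCompact K → Continuous ψ → ∀ᶠ n in atTop, ∀ c : ℝ,
      ((κ ^ n) y).real {z | z ∉ K ∨ δ ≤ |ψ z - c|} < δ →
        ((κ ^ n) x).real {z | ε ≤ |ψ z - c|} < ε)
    {μ : Measure E} [IsProbabilityMeasure μ] (hμ : μ.bind κ = μ)
    {φ : E → ℝ} (hφ : Continuous φ) {M : ℝ} (hM : ∀ y, |φ y| ≤ M) :
    Tendsto (fun n : ℕ => ∫ z, φ z ∂((κ ^ n) x)) atTop (𝓝 (∫ z, φ z ∂μ)) := by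
  have hM0 : 0 ≤ M := (abs_nonneg _).trans (hM x)
  set F : ℕ → E → ℝ := fun n y => ∫ w, φ w ∂((κ ^ n) y) with hFdef
  have hFc : ∀ n, Continuous (F n) := continuous_integral_pow hF hφ hM
  have hFm : ∀ n, Measurable (F n) := fun n => (hFc n).measurable
  have hFb : ∀ n y, |F n y| ≤ M := fun n y => abs_integral_le_of_abs_le hM
  have hdiff : ∀ n c, |c| ≤ M → ∀ y, |F n y - c| ≤ 2 * M := fun n c hc y =>
    (abs_sub _ _).trans (by linarith [hFb n y])
  by_contra hnot
  obtain ⟨v, hv, hfreq⟩ : ∃ v > 0, ∃ᶠ n in atTop, v ≤ |F n x - ∫ z, φ z ∂μ| := by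
    rw [Metric.tendsto_nhds] at hnot
    push Not at hnot
    obtain ⟨v, hv, h⟩ := hnot
    exact ⟨v, hv, h.mono fun n hn => by simpa [Real.dist_eq] using hn⟩
  set c : ℝ := v / (4 * (M + 1)) with hc
  have hcpos : 0 < c := by positivity
  have hB : ∀ n, v ≤ |F n x - ∫ z, φ z ∂μ| → c ≤ μ.real {y | v / 2 ≤ |F n y - F n x|} := by
    intro n hn
    have h1 := abs_integral_le_add_mul_measureReal (μ := μ) ((hFm n).sub_const (F n x))
      (half_pos hv).le (hdiff n _ (hFb n x))
    rw [integral_sub (integrable_of_abs_le (hFm n) (hFb n)) (integrable_const _),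
      integral_integral_of_bind_eq (bind_pow_eq_self hμ n)
        (integrable_of_abs_le hφ.measurable hM), integral_const, probReal_univ, one_smul,
      abs_sub_comm] at h1
    rw [hc, div_le_iff₀ (by positivity)]
    have : 0 ≤ μ.real {y | v / 2 ≤ |F n y - F n x|} := measureReal_nonneg
    nlinarith
  set e : ℕ → ℝ := fun k => c / 2 / (k + 1) with he
  have hepos : ∀ k, 0 < e k := fun k => by positivity
  choose L K hK hLK using fun k =>
    exists_measureReal_deviation_le hμ hφ.measurable hM (hepos k)
  set bad : ℕ → ℕ → Set E := fun k n => {y | e k ≤ ((κ ^ n) y).real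
    {z | z ∉ K k ∨ e k ≤ |F (L k) z - F (n + L k) y|}} with hbad
  set C : ℕ → ℕ → Set E := fun k n =>
    {y | v / 2 ≤ |F (n + L k) y - F (n + L k) x|} \ bad k n with hCdef
  have hCm : ∀ k n, MeasurableSet (C k n) := fun k n =>
    (measurableSet_le measurable_const ((hFm _).sub_const _).abs).diff (hLK k n).1
  have hCμ : ∀ k, ∃ᶠ n in atTop, c / 2 ≤ μ.real (C k n) := by
    intro k
    have hshift : ∃ᶠ n in atTop, v ≤ |F (n + L k) x - ∫ z, φ z ∂μ| := by
      rw [← map_add_atTop_eq_nat (L k)] at hfreq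
      exact hfreq
    refine hshift.mono fun n hn => ?_
    have h1 := hB _ hn
    have h2 : μ.real (bad k n) ≤ e k := (hLK k n).2
    have h3 : e k ≤ c / 2 := div_le_self (by positivity) (by linarith [k.cast_nonneg (α := ℝ)])
    have h4 := le_measureReal_sdiff (μ := μ)
      (s₁ := {y | v / 2 ≤ |F (n + L k) y - F (n + L k) x|}) (s₂ := bad k n)
    linarith
  have hlim := le_measureReal_frequently_mem (μ := μ)
    (fun k => measurableSet_frequently_mem (hCm k))
    (Frequently.of_forall fun k => le_measureReal_frequently_mem (hCm k) (hCμ k))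
  obtain ⟨y, hy⟩ : {y | ∃ᶠ k in atTop, y ∈ {y | ∃ᶠ n in atTop, y ∈ C k n}}.Nonempty := by
    by_contra hempty
    rw [Set.not_nonempty_iff_eq_empty] at hempty
    rw [hempty, measureReal_empty] at hlim
    linarith
  set ε : ℝ := v / (8 * (M + 1)) with hεdef
  have hε : 0 < ε := by positivity
  obtain ⟨δ, hδ, hT⟩ := htransfer y ε hε
  have hesmall : ∀ᶠ k in atTop, e k < δ := by
    have : Tendsto e atTop (𝓝 0) := by
      simpa [he, div_eq_mul_inv] using
        (tendsto_one_div_add_atTop_nhds_zero_nat (𝕜 := ℝ)).const_mul (c / 2)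
    exact (tendsto_order.1 this).2 δ hδ
  obtain ⟨k, hyk, hek⟩ := (hy.and_eventually hesmall).exists
  obtain ⟨n, hyn, hTn⟩ :=
    (Frequently.and_eventually hyk (hT (K k) (F (L k)) (hK k) (hFc (L k)))).exists
  obtain ⟨hyv, hyb⟩ := hyn
  have hyb' : ((κ ^ n) y).real {z | z ∉ K k ∨ e k ≤ |F (L k) z - F (n + L k) y|} < e k :=
    not_le.1 hyb
  have hx : ((κ ^ n) x).real {z | ε ≤ |F (L k) z - F (n + L k) y|} < ε := by
    refine hTn _ (lt_of_le_of_lt (measureReal_mono ?_) (hyb'.trans hek))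
    rintro z (hz | hz)
    · exact Or.inl hz
    · exact Or.inr (hek.le.trans hz)
  have h1 := abs_integral_le_add_mul_measureReal (μ := (κ ^ n) x)
    ((hFm (L k)).sub_const (F (n + L k) y)) hε.le (hdiff (L k) _ (hFb _ y))
  rw [integral_sub (integrable_of_abs_le (hFm _) (hFb _)) (integrable_const _),
    ← integral_pow_add κ hφ.measurable hM n (L k) x, integral_const, probReal_univ, one_smul,
    abs_sub_comm] at h1
  have h2 : v / 2 ≤ ε + 2 * M * ε := by
    refine le_trans hyv (h1.trans ?_)
    have := mul_le_mul_of_nonneg_left hx.le (by positivity : (0 : ℝ) ≤ 2 * M)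
    linarith
  have h3 : ε * (8 * (M + 1)) = v := div_mul_cancel₀ _ (by positivity)
  nlinarith

/-- If the transition semigroup is Feller on `H` and for
all `x, y ∈ H` there is `ξ ∈ Ĉ(ℙ_x, ℙ_y)` with `π₁(ξ) ∼ ℙ_x` and
`ξ(‖u(n) − v(n)‖ ≤ ε) → 1` for every `ε > 0`, then there is at most one
invariant probability measure `μ`, and `ℒ(u(n;u₀)) ⇀ μ` for every
`u₀ ∈ H`. -/
theorem generalized_coupling_asymptotic_stability
    (H : Type*) [NormedAddCommGroup H] [InnerProductSpace ℝ H] [CompleteSpace H]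
    [SecondCountableTopology H] [MeasurableSpace H] [BorelSpace H]
    (κ : Kernel H H) (hκ : IsMarkovKernel κ)
    -- Feller property of the transition semigroup on `H`
    (hFeller : ∀ φ : H → ℝ, Continuous φ → (∃ M, ∀ y, |φ y| ≤ M) →
      Continuous fun x => ∫ y, φ y ∂(κ x))
    (law : H → Measure (ℕ → H))
    (hlaw_prob : ∀ x, IsProbabilityMeasure (law x))
    (hlaw_zero : ∀ x : H, Measure.map (fun ω => ω 0) (law x) = Measure.dirac x)
    (hlaw_markov : ∀ (x : H) (n : ℕ),
      Measure.map (fun ω => (fun i : Fin (n + 1) => ω i, ω (n + 1))) (law x) =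
        (Measure.map (fun ω (i : Fin (n + 1)) => ω i) (law x)) ⊗ₘ
          (κ.comap (fun v : Fin (n + 1) → H => v (Fin.last n))
            (measurable_pi_apply _)))
    -- the generalized coupling hypothesis
    (hcoupling : ∀ x y : H, ∃ ξ : Measure ((ℕ → H) × (ℕ → H)),
      IsProbabilityMeasure ξ ∧
      (ξ.map Prod.fst ≪ law x ∧ law x ≪ ξ.map Prod.fst) ∧
      ξ.map Prod.snd ≪ law y ∧
      ∀ ε : ℝ, 0 < ε →
        Tendsto (fun n => ξ {p | ‖p.1 n - p.2 n‖ ≤ ε}) atTop (𝓝 1)) :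
    -- at most one invariant probability measure ...
    (∀ μ₁ μ₂ : Measure H, IsProbabilityMeasure μ₁ → IsProbabilityMeasure μ₂ →
      μ₁.bind κ = μ₁ → μ₂.bind κ = μ₂ → μ₁ = μ₂) ∧
    -- ... and the laws `ℒ(u(n;u₀))` converge weakly to it
    (∀ μ : Measure H, IsProbabilityMeasure μ → μ.bind κ = μ →
      ∀ u₀ : H, ∀ φ : H → ℝ, Continuous φ → (∃ M, ∀ y, |φ y| ≤ M) →
        Tendsto (fun n : ℕ => ∫ y, φ y ∂(Measure.map (fun ω => ω n) (law u₀)))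
          atTop (𝓝 (∫ y, φ y ∂μ))) := by
  have hpow : ∀ x n, Measure.map (fun ω => ω n) (law x) = (κ ^ n) x := fun x n =>
    map_eval_eq_pow (hlaw_zero x) (hlaw_markov x) n
  have hreal : ∀ x n (s : Set H), MeasurableSet s →
      (law x).real {ω | ω n ∈ s} = ((κ ^ n) x).real s := fun x n s hs => by
    rw [← hpow x n, map_measureReal_apply (measurable_pi_apply n) hs]
    rfl
  have hconv : ∀ μ : Measure H, IsProbabilityMeasure μ → μ.bind κ = μ →
      ∀ u₀ : H, ∀ φ : H → ℝ, Continuous φ → (∃ M, ∀ y, |φ y| ≤ M) →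
        Tendsto (fun n : ℕ => ∫ y, φ y ∂(Measure.map (fun ω => ω n) (law u₀)))
          atTop (𝓝 (∫ y, φ y ∂μ)) := by
    rintro μ hμ hinv x φ hφ ⟨M, hM⟩
    simp_rw [hpow]
    refine tendsto_integral_pow_of_transfer hFeller (fun y ε hε => ?_) hinv hφ hM
    obtain ⟨ξ, hξ, ⟨-, h₁⟩, h₂, hlim⟩ := hcoupling x y
    simp_rw [← dist_eq_norm] at hlim
    obtain ⟨δ, hδ, hT⟩ := exists_transfer_of_generalized_coupling h₁ h₂ hlim hε
    refine ⟨δ, hδ, fun K ψ hK hψ => (hT K ψ hK hψ).mono fun n hn c => ?_⟩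
    have hψm : Measurable fun z => |ψ z - c| := (hψ.measurable.sub_const c).abs
    have hbad : MeasurableSet {z | z ∉ K ∨ δ ≤ |ψ z - c|} :=
      hK.isClosed.measurableSet.compl.union (measurableSet_le measurable_const hψm)
    rw [← hreal x n _ (measurableSet_le measurable_const hψm), ← hreal y n _ hbad]
    exact hn c
  refine ⟨fun μ₁ μ₂ hμ₁ hμ₂ hinv₁ hinv₂ => ?_, hconv⟩
  refine ext_of_forall_integral_eq_of_IsFiniteMeasure fun f => ?_
  have hf : ∃ M, ∀ y, |f y| ≤ M := ⟨‖f‖, fun y => f.norm_coe_le_norm y⟩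
  exact tendsto_nhds_unique (hconv μ₁ hμ₁ hinv₁ 0 f f.continuous hf)
    (hconv μ₂ hμ₂ hinv₂ 0 f f.continuous hf)
end
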